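/- arXiv:1706.00565 — 4 statements merged into one kernel-verified Lean document; each statement's English description precedes it below -/
import Mathlib

section
/- For each positive integer n, neither (M_n(𝔽), 𝔽, +, ×_𝔽, |·|) nor (M_n(𝔽), 𝔽, +, +_𝔽, ×_𝔽, |·|) is an e⃗-Ramsey algebra for any nonconstant e⃗ ∈ Ω_0. -/
universe u v

/-- A (heterogeneous) operation: a list of input sorts, an output sort, and an
underlying function on lists of elements (only its values on lists of the right
length and sorts matter). -/
structure HetOp (I : Type u) (U : Type v) where
  inSorts : List I
  outSort : I
  fn : List U → U

namespace HetRamsey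

variable {I : Type u} {U : Type v}

/-- `f` maps the phyla prescribed by its input sorts into the phylum of its output sort. -/
def WellSorted (A : I → Set U) (f : HetOp I U) : Prop :=
  ∀ xs : List U, List.Forall₂ (fun x ξ => x ∈ A ξ) xs f.inSorts → f.fn xs ∈ A f.outSort

/-- Apply the operations in `hs` to consecutive chunks of the list `xs`. -/
def applyChunks : List (HetOp I U) → List U → List U
  | [], _ => []
  | h :: t, xs => h.fn (xs.take h.inSorts.length) :: applyChunks t (xs.drop h.inSorts.length)

/-- The orderly terms over a family `F` of operations: `F` itself, the identity
operations, closed under orderly composition. -/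
inductive OT (F : Set (HetOp I U)) : HetOp I U → Prop
  | base {f : HetOp I U} : f ∈ F → OT F f
  | id (ξ : I) (c : HetOp I U) :
      c.inSorts = [ξ] → c.outSort = ξ → (∀ x : U, c.fn [x] = x) → OT F c
  | comp (g : HetOp I U) (hs : List (HetOp I U)) :
      g ∈ F → (∀ h ∈ hs, OT F h) →
      List.Forall₂ (fun (h : HetOp I U) ξ => h.outSort = ξ) hs g.inSorts →
      OT F ⟨(hs.map HetOp.inSorts).flatten, g.outSort, fun xs => g.fn (applyChunks hs xs)⟩

/-- `b` is `e`-sorted: the `i`-th term lies in phylum `A (e i)`. -/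
def Sorted (A : I → Set U) (e : ℕ → I) (b : ℕ → U) : Prop :=
  ∀ i, b i ∈ A (e i)

/-- `a` is a reduction of `b` with respect to the family of operations `F`:
each term `a j` is obtained by applying an orderly term over `F` to a finite
subsequence of `b`, and these finite subsequences concatenate to a
subsequence of `b`. -/
def Reduction (A : I → Set U) (F : Set (HetOp I U)) (a b : ℕ → U) : Prop :=
  ∃ (φ : ℕ → List ℕ) (f : ℕ → HetOp I U),
    (∀ j, OT F (f j)) ∧
    (∀ j, (φ j).Chain' (· < ·)) ∧
    (∀ j k, j < k → ∀ x ∈ φ j, ∀ y ∈ φ k, x < y) ∧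
    (∀ j, List.Forall₂ (fun i ξ => b i ∈ A ξ) (φ j) (f j).inSorts) ∧
    (∀ j, a j = (f j).fn ((φ j).map b))

/-- `FR^e_F(b)`: the set of first terms of `e`-sorted reductions of `b`. -/
def FR (A : I → Set U) (F : Set (HetOp I U)) (e : ℕ → I) (b : ℕ → U) : Set U :=
  { x | ∃ a : ℕ → U, Reduction A F a b ∧ Sorted A e a ∧ a 0 = x }

/-- The algebra with phyla `A` and operations `F` is an `e`-Ramsey algebra. -/
def IsERamsey (A : I → Set U) (F : Set (HetOp I U)) (e : ℕ → I) : Prop :=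
  ∀ b : ℕ → U, Sorted A e b → ∀ X : Set U, X ⊆ A (e 0) →
    ∃ a : ℕ → U, Reduction A F a b ∧ Sorted A e a ∧
      (FR A F e a ⊆ X ∨ FR A F e a ∩ X = ∅)

/-- The homogeneous algebra `(A ξ, F)` is a Ramsey algebra: it is `e`-Ramsey for
the constant sort with value `ξ`. -/
def IsRamsey (A : I → Set U) (F : Set (HetOp I U)) (ξ : I) : Prop :=
  IsERamsey A F fun _ => ξ

/-- For a homogeneous algebra: `FR_G(α) = { f(τ) : f ∈ OT(G), τ a finite subsequence of α }`. -/
def FRfin (A : I → Set U) (G : Set (HetOp I U)) (α : ℕ → U) : Set U :=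
  { x | ∃ (f : HetOp I U) (ns : List ℕ), OT G f ∧ ns.Chain' (· < ·) ∧
      List.Forall₂ (fun i ξ => α i ∈ A ξ) ns f.inSorts ∧ x = f.fn (ns.map α) }

/-- `e ∈ Ω`: every value attained by the sort `e` is attained infinitely often. -/
def InOmega (e : ℕ → I) : Prop :=
  ∀ i, {j | e j = e i}.Infinite

end HetRamsey
namespace HetRamsey

/-- The underlying universe of a matrix algebra: scalars (left) and matrices (right). -/
abbrev MatU (𝔽 : Type) (n : ℕ) : Type := 𝔽 ⊕ Matrix (Fin n) (Fin n) 𝔽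

/-- The two phyla: index `0` is the scalar phylum `𝔽`, index `1` the matrix phylum. -/
def matPhyla (𝔽 : Type) (n : ℕ) : Fin 2 → Set (MatU 𝔽 n) :=
  fun i => if i = 0 then Set.range Sum.inl else Set.range Sum.inr

def toScal {𝔽 : Type} [Zero 𝔽] {n : ℕ} : MatU 𝔽 n → 𝔽
  | Sum.inl r => r
  | Sum.inr _ => 0

def toMat {𝔽 : Type} [Zero 𝔽] {n : ℕ} : MatU 𝔽 n → Matrix (Fin n) (Fin n) 𝔽
  | Sum.inl _ => 0
  | Sum.inr m => m

/-- Matrix addition as a heterogeneous operation. -/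
def matAddOp (𝔽 : Type) [Field 𝔽] (n : ℕ) : HetOp (Fin 2) (MatU 𝔽 n) :=
  ⟨[1, 1], 1, fun xs => match xs with
    | [x, y] => Sum.inr (toMat x + toMat y)
    | _ => Sum.inl 0⟩

/-- Matrix multiplication as a heterogeneous operation. -/
def matMulOp (𝔽 : Type) [Field 𝔽] (n : ℕ) : HetOp (Fin 2) (MatU 𝔽 n) :=
  ⟨[1, 1], 1, fun xs => match xs with
    | [x, y] => Sum.inr (toMat x * toMat y)
    | _ => Sum.inl 0⟩

/-- Field addition as a heterogeneous operation. -/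
def scalAddOp (𝔽 : Type) [Field 𝔽] (n : ℕ) : HetOp (Fin 2) (MatU 𝔽 n) :=
  ⟨[0, 0], 0, fun xs => match xs with
    | [x, y] => Sum.inl (toScal x + toScal y)
    | _ => Sum.inl 0⟩

/-- Field multiplication as a heterogeneous operation. -/
def scalMulOp (𝔽 : Type) [Field 𝔽] (n : ℕ) : HetOp (Fin 2) (MatU 𝔽 n) :=
  ⟨[0, 0], 0, fun xs => match xs with
    | [x, y] => Sum.inl (toScal x * toScal y)
    | _ => Sum.inl 0⟩

/-- The determinant as a heterogeneous operation from the matrix phylum to the scalar phylum. -/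
def detOp (𝔽 : Type) [Field 𝔽] (n : ℕ) : HetOp (Fin 2) (MatU 𝔽 n) :=
  ⟨[1], 0, fun xs => match xs with
    | [x] => Sum.inl (toMat x).det
    | _ => Sum.inl 0⟩

end HetRamsey

namespace HetRamsey

section General

variable {I : Type*} {U : Type*} {A : I → Set U} {F : Set (HetOp I U)}

theorem forall₂_applyChunks (hs : List (HetOp I U)) (hw : ∀ h ∈ hs, WellSorted A h)
    (xs : List U)
    (hxs : List.Forall₂ (fun x ξ => x ∈ A ξ) xs (hs.map HetOp.inSorts).flatten) :
    List.Forall₂ (fun x ξ => x ∈ A ξ) (applyChunks hs xs) (hs.map HetOp.outSort) := by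
  induction hs generalizing xs with
  | nil => exact List.Forall₂.nil
  | cons h t ih =>
    rw [List.map_cons, List.flatten_cons] at hxs
    exact List.Forall₂.cons
      (hw h List.mem_cons_self _ (List.forall₂_take_append _ _ _ hxs))
      (ih (fun h' hh' => hw h' (List.mem_cons_of_mem _ hh')) _
        (List.forall₂_drop_append _ _ _ hxs))

/-- Orderly terms preserve every family of subsets preserved by the basic operations. -/
theorem OT.wellSorted (hF : ∀ f ∈ F, WellSorted A f) {f : HetOp I U} (hf : OT F f) :
    WellSorted A f := by
  induction hf with
  | base h => exact hF _ h
  | id ξ c hin hout hfn =>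
    intro xs hxs
    rw [hin] at hxs
    obtain ⟨x, l, hx, hl, rfl⟩ := List.forall₂_cons_right_iff.1 hxs
    obtain rfl := List.forall₂_nil_right_iff.1 hl
    rwa [hfn, hout]
  | comp g hs hg _ hout ih =>
    intro xs hxs
    have hsorts : hs.map HetOp.outSort = g.inSorts := by
      rw [← List.forall₂_eq_eq_eq, List.forall₂_map_left_iff]
      exact hout
    exact hF g hg _ (hsorts ▸ forall₂_applyChunks hs ih xs hxs)

/-- In an infinitely recurring sort, every value of the right sort that an orderly term takes on
a finite subsequence is the first term of a sorted reduction. -/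
theorem mem_FR_of_mem_FRfin {e : ℕ → I} (he : InOmega e) {a : ℕ → U} (ha : Sorted A e a)
    {x : U} (hx : x ∈ FRfin A F a) (hx0 : x ∈ A (e 0)) : x ∈ FR A F e a := by
  obtain ⟨f, ns, hf, hns, hsorts, rfl⟩ := hx
  have hnext : ∀ k N, ∃ j, N < j ∧ e j = e (k + 1) := fun k N =>
    let ⟨j, hj, hN⟩ := (he (k + 1)).exists_gt N
    ⟨j, hN, hj⟩
  choose next hlt hnext_sort using hnext
  let g : ℕ → ℕ := fun k => Nat.rec (next 0 ns.sum) (fun k r => next (k + 1) r) k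
  have hg : StrictMono g := strictMono_nat_of_lt_succ fun k => hlt (k + 1) (g k)
  have hg_sort : ∀ k, e (g k) = e (k + 1) := by
    rintro (_ | k)
    · exact hnext_sort 0 _
    · exact hnext_sort (k + 1) _
  have hns_lt : ∀ i ∈ ns, ∀ k, i < g k := fun i hi k =>
    (List.le_sum_of_mem hi).trans_lt ((hlt 0 _).trans_le (hg.monotone k.zero_le))
  let idOp : ℕ → HetOp I U := fun k => ⟨[e (k + 1)], e (k + 1), fun xs => xs.headD (a 0)⟩
  refine ⟨fun j => Nat.casesOn j (f.fn (ns.map a)) fun k => a (g k),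
    ⟨fun j => Nat.casesOn j ns fun k => [g k], fun j => Nat.casesOn j f idOp,
      ?_, ?_, ?_, ?_, ?_⟩, ?_, rfl⟩
  · rintro (_ | k)
    · exact hf
    · exact OT.id (e (k + 1)) _ rfl rfl fun _ => rfl
  · rintro (_ | k)
    · exact hns
    · exact List.isChain_singleton _
  · rintro (_ | j) (_ | k) hjk x hx y hy
    · exact absurd hjk (lt_irrefl _)
    · obtain rfl := List.mem_singleton.1 hy
      exact hns_lt x hx k
    · exact absurd hjk (Nat.not_lt_zero _)
    · obtain rfl := List.mem_singleton.1 hx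
      obtain rfl := List.mem_singleton.1 hy
      exact hg (Nat.lt_of_succ_lt_succ hjk)
  · rintro (_ | k)
    · exact hsorts
    · exact List.Forall₂.cons (hg_sort k ▸ ha (g k)) List.Forall₂.nil
  · rintro (_ | k) <;> rfl
  · rintro (_ | k)
    · exact hx0
    · exact (hg_sort k ▸ ha (g k) : a (g k) ∈ A (e (k + 1)))

end General

section MatrixAlgebra

variable {𝔽 : Type} [Field 𝔽] {n : ℕ}

/-- The scalars together with the positive integer multiples of the matrix `D`. -/
def multiplesPhyla (D : Matrix (Fin n) (Fin n) 𝔽) : Fin 2 → Set (MatU 𝔽 n) :=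
  fun i => if i = 0 then Set.range Sum.inl
    else {x | ∃ k : ℕ, 0 < k ∧ x = Sum.inr ((k : 𝔽) • D)}

theorem wellSorted_multiplesPhyla (D : Matrix (Fin n) (Fin n) 𝔽) :
    ∀ f ∈ ({matAddOp 𝔽 n, scalAddOp 𝔽 n, scalMulOp 𝔽 n, detOp 𝔽 n} :
      Set (HetOp (Fin 2) (MatU 𝔽 n))), WellSorted (multiplesPhyla D) f := by
  rintro f (rfl | rfl | rfl | rfl) xs hxs
  · obtain ⟨x, l, hx, hl, rfl⟩ := List.forall₂_cons_right_iff.1 hxs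
    obtain ⟨y, l', hy, hl', rfl⟩ := List.forall₂_cons_right_iff.1 hl
    obtain rfl := List.forall₂_nil_right_iff.1 hl'
    obtain ⟨k, hk, rfl⟩ := hx
    obtain ⟨m, hm, rfl⟩ := hy
    exact ⟨k + m, by omega, by simp [matAddOp, toMat, add_smul]⟩
  · obtain ⟨x, l, hx, hl, rfl⟩ := List.forall₂_cons_right_iff.1 hxs
    obtain ⟨y, l', hy, hl', rfl⟩ := List.forall₂_cons_right_iff.1 hl
    obtain rfl := List.forall₂_nil_right_iff.1 hl'
    exact ⟨_, rfl⟩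
  · obtain ⟨x, l, hx, hl, rfl⟩ := List.forall₂_cons_right_iff.1 hxs
    obtain ⟨y, l', hy, hl', rfl⟩ := List.forall₂_cons_right_iff.1 hl
    obtain rfl := List.forall₂_nil_right_iff.1 hl'
    exact ⟨_, rfl⟩
  · obtain ⟨x, l, hx, hl, rfl⟩ := List.forall₂_cons_right_iff.1 hxs
    obtain rfl := List.forall₂_nil_right_iff.1 hl
    exact ⟨_, rfl⟩

theorem exists_det_eq_neg_one (hn : 0 < n) : ∃ D : Matrix (Fin n) (Fin n) 𝔽, D.det = -1 := by
  refine ⟨Matrix.diagonal fun i => if i = ⟨0, hn⟩ then -1 else 1, ?_⟩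
  rw [Matrix.det_diagonal, Finset.prod_ite_eq' Finset.univ (⟨0, hn⟩ : Fin n) fun _ => (-1 : 𝔽)]
  simp

/-- No family of operations among matrix addition, field addition, field multiplication and the
determinant that contains the last two yields an `e`-Ramsey algebra. -/
theorem not_isERamsey_of_subset [CharZero 𝔽] (hn : 0 < n) {e : ℕ → Fin 2} (he : InOmega e)
    (he0 : e 0 = 0) (hnc : ∃ i j, e i ≠ e j) {F : Set (HetOp (Fin 2) (MatU 𝔽 n))}
    (hF : F ⊆ {matAddOp 𝔽 n, scalAddOp 𝔽 n, scalMulOp 𝔽 n, detOp 𝔽 n})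
    (hmul : scalMulOp 𝔽 n ∈ F) (hdet : detOp 𝔽 n ∈ F) :
    ¬ IsERamsey (matPhyla 𝔽 n) F e := by
  intro hR
  obtain ⟨D, hD⟩ := exists_det_eq_neg_one (𝔽 := 𝔽) hn
  let b : ℕ → MatU 𝔽 n := fun i => if e i = 0 then Sum.inl 1 else Sum.inr D
  have hb : Sorted (matPhyla 𝔽 n) e b := by
    intro i
    by_cases h : e i = 0 <;> simp [b, matPhyla, h]
  have hb' : ∀ i ξ, b i ∈ matPhyla 𝔽 n ξ → b i ∈ multiplesPhyla D ξ := by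
    intro i ξ h
    by_cases hi : e i = 0 <;> by_cases hξ : ξ = 0 <;>
      simp [b, matPhyla, multiplesPhyla, hi, hξ] at h ⊢
    exact ⟨1, one_pos, by simp⟩
  obtain ⟨a, ⟨φ, f, hf, -, -, hφ, haf⟩, ha, hX⟩ := hR b hb
    {x | ∃ k : ℕ, 0 < k ∧ x = Sum.inl (-(k : 𝔽))} (by
      rintro _ ⟨k, -, rfl⟩
      rw [he0]
      exact ⟨_, rfl⟩)
  have ha' : ∀ j, e j = 1 → ∃ k : ℕ, 0 < k ∧ a j = Sum.inr ((k : 𝔽) • D) := by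
    intro j hj
    have hmem : a j ∈ multiplesPhyla D (f j).outSort := by
      rw [haf]
      exact (hf j).wellSorted (fun g hg => wellSorted_multiplesPhyla D g (hF hg)) _
        (List.forall₂_map_left_iff.2 ((hφ j).imp fun {i ξ} h => hb' i ξ h))
    have hmat : a j ∈ Set.range Sum.inr := by
      have := ha j
      rwa [hj] at this
    obtain ⟨M, hM⟩ := hmat
    by_cases h0 : (f j).outSort = 0
    · rw [h0, ← hM] at hmem
      obtain ⟨r, hr⟩ := hmem
      cases hr
    · simpa [multiplesPhyla, h0] using hmem
  obtain ⟨i, hi⟩ : ∃ i, e i = 1 := by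
    obtain ⟨i, j, hij⟩ := hnc
    by_contra! h
    exact hij (by have := h i; have := h j; omega)
  obtain ⟨j, hj, hij⟩ := (he i).exists_gt i
  have hj : e j = 1 := hj.trans hi
  obtain ⟨k, hk, hak⟩ := ha' i hi
  obtain ⟨m, hm, ham⟩ := ha' j hj
  have hai : a i ∈ matPhyla 𝔽 n 1 := hi ▸ ha i
  have haj : a j ∈ matPhyla 𝔽 n 1 := hj ▸ ha j
  have hmem_scal : ∀ r : 𝔽, (Sum.inl r : MatU 𝔽 n) ∈ matPhyla 𝔽 n (e 0) := fun r => by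
    rw [he0]
    exact ⟨r, rfl⟩
  have hdet_mem : (Sum.inl (-((k ^ n : ℕ) : 𝔽)) : MatU 𝔽 n) ∈ FR (matPhyla 𝔽 n) F e a := by
    refine mem_FR_of_mem_FRfin he ha ⟨_, [i], OT.base hdet, List.isChain_singleton _,
      .cons hai .nil, ?_⟩ (hmem_scal _)
    simp [detOp, hak, toMat, hD]
  have hmul_mem : (Sum.inl (((k * m) ^ n : ℕ) : 𝔽) : MatU 𝔽 n) ∈ FR (matPhyla 𝔽 n) F e a := by
    refine mem_FR_of_mem_FRfin he ha ⟨_, [i, j],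
      OT.comp (scalMulOp 𝔽 n) [detOp 𝔽 n, detOp 𝔽 n] hmul (by simp [OT.base hdet])
        (.cons rfl (.cons rfl .nil)), List.isChain_pair.2 hij,
      .cons hai (.cons haj .nil), ?_⟩ (hmem_scal _)
    simp [scalMulOp, applyChunks, detOp, hak, ham, toMat, toScal, hD, mul_pow]
  rcases hX with hX | hX
  · obtain ⟨l, hl, h⟩ := hX hmul_mem
    have h := Sum.inl.inj h
    rw [eq_neg_iff_add_eq_zero] at h
    norm_cast at h
    omega
  · exact (Set.eq_empty_iff_forall_notMem.1 hX _) ⟨hdet_mem, k ^ n, pow_pos hk n, rfl⟩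

end MatrixAlgebra

end HetRamsey

open HetRamsey

/-- for nonconstant `e ∈ Ω₀`, neither `(Mₙ(𝔽), 𝔽, +, ×_𝔽, |·|)`
nor `(Mₙ(𝔽), 𝔽, +, +_𝔽, ×_𝔽, |·|)` is an `e`-Ramsey algebra. -/
theorem matAdd_scalMul_det_reducts_not_eRamsey
    (𝔽 : Type) [Field 𝔽] [CharZero 𝔽] (n : ℕ) (hn : 0 < n)
    (e : ℕ → Fin 2) (he : InOmega e) (he0 : e 0 = 0)
    (hnc : ∃ i j, e i ≠ e j) :
    ¬ IsERamsey (matPhyla 𝔽 n) {matAddOp 𝔽 n, scalMulOp 𝔽 n, detOp 𝔽 n} e ∧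
    ¬ IsERamsey (matPhyla 𝔽 n) {matAddOp 𝔽 n, scalAddOp 𝔽 n, scalMulOp 𝔽 n, detOp 𝔽 n} e := by
  refine ⟨not_isERamsey_of_subset hn he he0 hnc ?_ ?_ ?_,
    not_isERamsey_of_subset hn he he0 hnc subset_rfl ?_ ?_⟩
  · rintro f (rfl | rfl | rfl) <;> simp
  all_goals simp
end

section
/- For each positive integer n, the matrix algebra (M_n(𝔽), 𝔽, ×_𝔽, |·|) is not an e⃗-Ramsey algebra for any nonconstant e⃗ ∈ Ω_0. -/
universe u v

namespace HetRamsey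

section General

variable {I : Type u} {U : Type v}

theorem InOmega.exists_gt {e : ℕ → I} (he : InOmega e) (i N : ℕ) : ∃ m, N < m ∧ e m = e i := by
  obtain ⟨m, hm, hlt⟩ := (he i).exists_gt N
  exact ⟨m, hlt, hm⟩

/-- For `e ∈ Ω`, every value of an orderly term at a finite subsequence of an `e`-sorted sequence
is the first term of an `e`-sorted reduction, provided that it lies in the phylum `A (e 0)`. -/
theorem InOmega.mem_FR {A : I → Set U} {F : Set (HetOp I U)} {e : ℕ → I} (he : InOmega e)
    {a : ℕ → U} (ha : Sorted A e a) {f : HetOp I U} (hf : OT F f) {L : List ℕ}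
    (hL : L.IsChain (· < ·)) (hs : List.Forall₂ (fun i ξ => a i ∈ A ξ) L f.inSorts)
    (h0 : f.fn (L.map a) ∈ A (e 0)) : f.fn (L.map a) ∈ FR A F e a := by
  choose next hlt hnext using he.exists_gt
  let χ : ℕ → ℕ := fun k => Nat.rec (motive := fun _ => ℕ) L.sum (fun k c => next (k + 1) c) k
  have hχ : StrictMono χ := strictMono_nat_of_lt_succ fun k => hlt (k + 1) (χ k)
  have heχ (k : ℕ) : e (χ (k + 1)) = e (k + 1) := hnext (k + 1) (χ k)
  let φ : ℕ → List ℕ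
    | 0 => L
    | k + 1 => [χ (k + 1)]
  let ops : ℕ → HetOp I U
    | 0 => f
    | k + 1 => ⟨[e (k + 1)], e (k + 1), fun xs => xs.headD (a 0)⟩
  refine ⟨fun j => (ops j).fn ((φ j).map a),
    ⟨φ, ops, ?_, ?_, ?_, ?_, fun _ => rfl⟩, ?_, rfl⟩
  · rintro (_ | k)
    · exact hf
    · exact OT.id (e (k + 1)) _ rfl rfl fun _ => rfl
  · rintro (_ | k)
    · exact hL
    · exact List.isChain_singleton _
  · rintro (_ | j) (_ | k) hjk x hx y hy
    · omega
    · obtain rfl : y = χ (k + 1) := by simpa [φ] using hy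
      exact (List.le_sum_of_mem hx).trans_lt (hχ (Nat.succ_pos k))
    · omega
    · obtain rfl : x = χ (j + 1) := by simpa [φ] using hx
      obtain rfl : y = χ (k + 1) := by simpa [φ] using hy
      exact hχ hjk
  · rintro (_ | k)
    · exact hs
    · have h := ha (χ (k + 1))
      rw [heχ] at h
      exact List.Forall₂.cons h List.Forall₂.nil
  · rintro (_ | k)
    · exact h0
    · have h := ha (χ (k + 1))
      rw [heχ] at h
      exact h

end General

variable {𝔽 : Type} [Field 𝔽] {n : ℕ}

theorem exists_fn_eq_inl_of_mem {g : HetOp (Fin 2) (MatU 𝔽 n)}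
    (hg : g ∈ ({scalMulOp 𝔽 n, detOp 𝔽 n} : Set _)) (xs : List (MatU 𝔽 n)) :
    ∃ r, g.fn xs = Sum.inl r := by
  rcases hg with rfl | rfl
  · dsimp only [scalMulOp]
    split <;> exact ⟨_, rfl⟩
  · dsimp only [detOp]
    split <;> exact ⟨_, rfl⟩

/-- Field multiplication and the determinant produce no new matrices: a matrix value of an orderly
term is one of its arguments. -/
theorem OT.mem_of_fn_eq_inr {f : HetOp (Fin 2) (MatU 𝔽 n)}
    (hf : OT {scalMulOp 𝔽 n, detOp 𝔽 n} f) {xs : List (MatU 𝔽 n)}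
    (hlen : xs.length = f.inSorts.length) {M : Matrix (Fin n) (Fin n) 𝔽}
    (hM : f.fn xs = Sum.inr M) : Sum.inr M ∈ xs := by
  cases hf with
  | base hg =>
    obtain ⟨r, hr⟩ := exists_fn_eq_inl_of_mem hg xs
    simp [hr] at hM
  | id ξ _ hin _ hid =>
    rw [hin] at hlen
    obtain ⟨x, rfl⟩ := List.length_eq_one_iff.1 hlen
    rw [hid] at hM
    simp [hM]
  | comp g hs hg _ _ =>
    obtain ⟨r, hr⟩ := exists_fn_eq_inl_of_mem hg (applyChunks hs xs)
    simp [hr] at hM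

theorem Reduction.exists_eq_of_eq_inr {A : Fin 2 → Set (MatU 𝔽 n)} {a b : ℕ → MatU 𝔽 n}
    (hab : Reduction A {scalMulOp 𝔽 n, detOp 𝔽 n} a b) {j : ℕ} {M : Matrix (Fin n) (Fin n) 𝔽}
    (hM : a j = Sum.inr M) : ∃ i, b i = Sum.inr M := by
  obtain ⟨φ, f, hf, -, -, hs, hval⟩ := hab
  have h := (hf j).mem_of_fn_eq_inr (xs := (φ j).map b) (by simpa using (hs j).length_eq)
    ((hval j).symm.trans hM)
  obtain ⟨i, -, hi⟩ := List.mem_map.1 h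
  exact ⟨i, hi⟩

theorem exists_det_eq (hn : 0 < n) (r : 𝔽) : ∃ D : Matrix (Fin n) (Fin n) 𝔽, D.det = r := by
  refine ⟨Matrix.diagonal (Function.update 1 ⟨0, hn⟩ r), ?_⟩
  rw [Matrix.det_diagonal, Finset.prod_update_of_mem (Finset.mem_univ _)]
  simp

theorem inl_det_mem_FR {e : ℕ → Fin 2} (he : InOmega e) (he0 : e 0 = 0) {a : ℕ → MatU 𝔽 n}
    (ha : Sorted (matPhyla 𝔽 n) e a) {i : ℕ} {M : Matrix (Fin n) (Fin n) 𝔽}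
    (hi : a i = Sum.inr M) :
    Sum.inl M.det ∈ FR (matPhyla 𝔽 n) {scalMulOp 𝔽 n, detOp 𝔽 n} e a := by
  have h := he.mem_FR ha (F := {scalMulOp 𝔽 n, detOp 𝔽 n}) (f := detOp 𝔽 n) (L := [i])
    (OT.base (by simp)) (List.isChain_singleton _) (by simp [detOp, matPhyla, hi]) (by simp [detOp, matPhyla, he0])
  simpa [detOp, hi, toMat] using h

theorem inl_det_mul_det_mem_FR {e : ℕ → Fin 2} (he : InOmega e) (he0 : e 0 = 0)
    {a : ℕ → MatU 𝔽 n} (ha : Sorted (matPhyla 𝔽 n) e a) {i j : ℕ} (hij : i < j)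
    {M N : Matrix (Fin n) (Fin n) 𝔽} (hi : a i = Sum.inr M) (hj : a j = Sum.inr N) :
    Sum.inl (M.det * N.det) ∈ FR (matPhyla 𝔽 n) {scalMulOp 𝔽 n, detOp 𝔽 n} e a := by
  have hdet : OT {scalMulOp 𝔽 n, detOp 𝔽 n} (detOp 𝔽 n) := OT.base (by simp)
  have h := he.mem_FR ha (L := [i, j])
    (OT.comp (F := {scalMulOp 𝔽 n, detOp 𝔽 n}) (scalMulOp 𝔽 n) [detOp 𝔽 n, detOp 𝔽 n]
      (by simp) (by simpa using hdet) (by simp [scalMulOp, detOp]))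
    (by simpa using hij) (by simp [detOp, matPhyla, hi, hj])
    (by simp [scalMulOp, detOp, applyChunks, matPhyla, he0])
  simpa [scalMulOp, detOp, applyChunks, hi, hj, toMat, toScal] using h

end HetRamsey

open HetRamsey

/-- for nonconstant `e ∈ Ω₀`, the matrix algebra
`(Mₙ(𝔽), 𝔽, ×_𝔽, |·|)` is not an `e`-Ramsey algebra. -/
theorem scalMul_det_not_eRamsey
    (𝔽 : Type) [Field 𝔽] [CharZero 𝔽] (n : ℕ) (hn : 0 < n)
    (e : ℕ → Fin 2) (he : InOmega e) (he0 : e 0 = 0)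
    (hnc : ∃ i j, e i ≠ e j) :
    ¬ IsERamsey (matPhyla 𝔽 n) {scalMulOp 𝔽 n, detOp 𝔽 n} e := by
 
  intro hR
  obtain ⟨D, hD⟩ := exists_det_eq hn (2 : 𝔽)
  let b : ℕ → MatU 𝔽 n := fun i => if e i = 0 then Sum.inl 0 else Sum.inr D
  have hb : Sorted (matPhyla 𝔽 n) e b := by
    intro i
    by_cases h : e i = 0 <;> simp [b, matPhyla, h]
  obtain ⟨a, hab, ha, hX⟩ := hR b hb {Sum.inl 2} (by simp [matPhyla, he0])
  have hmat {j : ℕ} (hj : e j ≠ 0) : a j = Sum.inr D := by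
    obtain ⟨M, hM⟩ : a j ∈ Set.range Sum.inr := by simpa [matPhyla, hj] using ha j
    obtain ⟨i, hi⟩ := hab.exists_eq_of_eq_inr hM.symm
    by_cases h : e i = 0
    · simp [b, h] at hi
    · simp only [b, h, if_false] at hi
      rw [← hM, hi]
  obtain ⟨j, hj⟩ : ∃ j, e j ≠ 0 := by
    by_contra! h
    obtain ⟨i, j, hij⟩ := hnc
    exact hij ((h i).trans (h j).symm)
  obtain ⟨k, hjk, hk⟩ := he.exists_gt j j
  have h2 := inl_det_mem_FR he he0 ha (hmat hj)
  have h4 := inl_det_mul_det_mem_FR he he0 ha hjk (hmat hj) (hmat (hk ▸ hj))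
  rw [hD] at h2 h4
  rcases hX with hX | hX
  · have h := hX h4
    norm_num at h
  · exact (hX ▸ ⟨h2, rfl⟩ : Sum.inl 2 ∈ (∅ : Set (MatU 𝔽 n)))
end

section
/- Let L, M, N be positive integers and let 0 < i_1 < ⋯ < i_L and 0 < j_1 < ⋯ < j_M < k_1 < ⋯ < k_N be integers. Then (2^{2^{i_1}} + ⋯ + 2^{2^{i_L}})^2 ≠ (2^{2^{j_1}} + ⋯ + 2^{2^{j_M}})^2 + (2^{2^{k_1}} + ⋯ + 2^{2^{k_N}})^2. -/
lemma sum_range_two_pow_two_pow_lt (n : ℕ) : ∑ s ∈ Finset.range n, 2 ^ 2 ^ s < 2 ^ 2 ^ n := by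
  induction n with
  | zero => simp
  | succ n ih =>
    have h : 2 ^ 2 ^ n * 2 ≤ 2 ^ 2 ^ (n + 1) := by
      rw [← pow_succ]
      exact Nat.pow_le_pow_right two_pos
        (by have := Nat.one_le_two_pow (n := n); rw [pow_succ 2 n]; lia)
    rw [Finset.sum_range_succ]
    lia

lemma sum_two_pow_two_pow_le_sum_range {S : Finset ℕ} {n : ℕ} (h : ∀ s ∈ S, s < n) :
    ∑ s ∈ S, 2 ^ 2 ^ s ≤ ∑ s ∈ Finset.range n, 2 ^ 2 ^ s :=
  Finset.sum_le_sum_of_subset fun s hs => Finset.mem_range.2 (h s hs)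

lemma sq_sum_two_pow_two_pow_lt {S : Finset ℕ} {n : ℕ} (hn : 0 < n) (h : ∀ s ∈ S, s < n) :
    (∑ s ∈ S, 2 ^ 2 ^ s) ^ 2 < 4 * 2 ^ 2 ^ n := by
  obtain ⟨m, rfl⟩ := Nat.exists_eq_succ_of_ne_zero hn.ne'
  have h1 := sum_two_pow_two_pow_le_sum_range h
  rw [Finset.sum_range_succ] at h1
  have h2 := sum_range_two_pow_two_pow_lt m
  have h3 : (2 : ℕ) ^ 2 ^ (m + 1) = (2 ^ 2 ^ m) ^ 2 := by rw [← pow_mul, pow_succ]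
  rw [Nat.succ_eq_add_one, h3]
  calc _ < (2 * 2 ^ 2 ^ m) ^ 2 := Nat.pow_lt_pow_left (by lia) two_ne_zero
    _ = _ := by ring

lemma two_pow_two_pow_dvd_sum {S : Finset ℕ} {n : ℕ} (h : ∀ s ∈ S, n ≤ s) :
    2 ^ 2 ^ n ∣ ∑ s ∈ S, 2 ^ 2 ^ s :=
  Finset.dvd_sum fun s hs => pow_dvd_pow 2 (Nat.pow_le_pow_right two_pos (h s hs))

lemma sq_sum_two_pow_two_pow_ne_add_sq {I J K : Finset ℕ} {n : ℕ} (hJ : J.Nonempty)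
    (hI : ∀ s ∈ I, 0 < s) (hJn : ∀ s ∈ J, s < n) (hKn : ∀ s ∈ K, n ≤ s) (hn : n ∈ K) :
    (∑ s ∈ I, 2 ^ 2 ^ s) ^ 2 ≠ (∑ s ∈ J, 2 ^ 2 ^ s) ^ 2 + (∑ s ∈ K, 2 ^ 2 ^ s) ^ 2 := by
  intro h
  obtain ⟨j, hj⟩ := hJ
  have hb := sq_sum_two_pow_two_pow_lt (pos_of_gt (hJn j hj)) hJn
  have hb0 : 0 < ∑ s ∈ J, 2 ^ 2 ^ s := Finset.sum_pos (fun _ _ => by positivity) ⟨j, hj⟩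
  have hd : ∑ s ∈ I with s < n, 2 ^ 2 ^ s < 2 ^ 2 ^ n :=
    (sum_two_pow_two_pow_le_sum_range (by simp)).trans_lt (sum_range_two_pow_two_pow_lt n)
  have hd4 : ∑ s ∈ I with s < n, 2 ^ 2 ^ s = 0 ∨ 4 ≤ ∑ s ∈ I with s < n, 2 ^ 2 ^ s := by
    rcases (I.filter (· < n)).eq_empty_or_nonempty with he | ⟨x, hx⟩
    · left
      rw [he, Finset.sum_empty]
    · right
      calc 4 = 2 ^ 2 ^ 1 := by norm_num
        _ ≤ 2 ^ 2 ^ x := Nat.pow_le_pow_right two_pos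
          (Nat.pow_le_pow_right two_pos (hI x (Finset.mem_filter.1 hx).1))
        _ ≤ _ := Finset.single_le_sum (f := fun s => 2 ^ 2 ^ s) (fun _ _ => Nat.zero_le _) hx
  obtain ⟨e, he⟩ := two_pow_two_pow_dvd_sum (S := I.filter (¬ · < n)) (n := n) (by simp)
  obtain ⟨c, hc⟩ := two_pow_two_pow_dvd_sum hKn
  have hC : 4 ≤ 2 ^ 2 ^ n := by
    calc 4 = 2 ^ 2 ^ 1 := by norm_num
      _ ≤ 2 ^ 2 ^ n := Nat.pow_le_pow_right two_pos
          (Nat.pow_le_pow_right two_pos (pos_of_gt (hJn j hj)))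
  have hc0 : 0 < ∑ s ∈ K, 2 ^ 2 ^ s := Finset.sum_pos (fun _ _ => by positivity) ⟨n, hn⟩
  rw [← Finset.sum_filter_add_sum_filter_not I (· < n), he] at h
  rw [hc] at h hc0
  generalize ∑ s ∈ J, 2 ^ 2 ^ s = b at *
  generalize ∑ s ∈ I with s < n, 2 ^ 2 ^ s = d at *
  generalize 2 ^ 2 ^ n = C at *
  have hc1 : 1 ≤ c := Nat.pos_of_mul_pos_left hc0
  rcases lt_trichotomy e c with hlt | rfl | hgt
  · have : C * (e + 1) ≤ C * c := Nat.mul_le_mul_left C hlt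
    have : (d + C * e) ^ 2 < (C * c) ^ 2 := Nat.pow_lt_pow_left (by lia) two_ne_zero
    lia
  · rcases hd4 with rfl | hd4
    · nlinarith
    · have : C ≤ C * e := Nat.le_mul_of_pos_right C hc1
      nlinarith
  · have : C * (c + 1) ≤ C * e := Nat.mul_le_mul_left C hgt
    have : C ≤ C * c := Nat.le_mul_of_pos_right C hc1
    have : (C * c + C) ^ 2 ≤ (d + C * e) ^ 2 := Nat.pow_le_pow_left (by lia) 2
    nlinarith

/-- if `0 < i₁ < ⋯ < i_L` and `0 < j₁ < ⋯ < j_M < k₁ < ⋯ < k_N`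
are integers, then
`(2^{2^{i₁}} + ⋯ + 2^{2^{i_L}})² ≠ (2^{2^{j₁}} + ⋯ + 2^{2^{j_M}})² + (2^{2^{k₁}} + ⋯ + 2^{2^{k_N}})²`. -/
theorem sum_two_pow_two_pow_sq_ne_add_sq
    (L M N : ℕ) (hL : 0 < L) (hM : 0 < M) (hN : 0 < N)
    (i : Fin L → ℕ) (j : Fin M → ℕ) (k : Fin N → ℕ)
    (hi : StrictMono i) (hj : StrictMono j) (hk : StrictMono k)
    (hipos : ∀ p, 0 < i p) (hjpos : ∀ p, 0 < j p)
    (hjk : ∀ p q, j p < k q) :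
    (∑ p, 2 ^ 2 ^ i p) ^ 2 ≠ (∑ p, 2 ^ 2 ^ j p) ^ 2 + (∑ p, 2 ^ 2 ^ k p) ^ 2 := by
  have key : ∀ {n : ℕ} {f : Fin n → ℕ}, StrictMono f →
      ∑ p, 2 ^ 2 ^ f p = ∑ s ∈ Finset.univ.image f, 2 ^ 2 ^ s := by
    intro n f hf
    rw [Finset.sum_image hf.injective.injOn]
  rw [key hi, key hj, key hk]
  have : NeZero N := ⟨hN.ne'⟩
  refine sq_sum_two_pow_two_pow_ne_add_sq (n := k 0) ⟨j ⟨0, hM⟩, by simp⟩ ?_ ?_ ?_ (by simp)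
  · simpa using hipos
  · simpa using fun p => hjk p 0
  · simpa using fun p => hk.monotone (Fin.zero_le p)
end

section
/- Let n be a positive integer. (1) If n = 1, then the matrix algebra (M_1(𝔽), 𝔽, +, +_𝔽, |·|) is an e⃗-Ramsey algebra for every e⃗ ∈ Ω_0. (2) If n > 1, then the matrix algebra (M_n(𝔽), 𝔽, +, +_𝔽, |·|) is not an e⃗-Ramsey algebra for any nonconstant e⃗ ∈ Ω_0. -/
universe u v

namespace HetRamsey

section OrderlyTerms

variable {I U M : Type*} [AddMonoid M] {P : I → U → Prop} {v : U → M} {F : Set (HetOp I U)}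

/-- `f` preserves the sorted predicate `P`, and turns its inputs into an output whose
`v`-value is the sum of the `v`-values of the inputs. -/
def Respects (P : I → U → Prop) (v : U → M) (f : HetOp I U) : Prop :=
  ∀ xs : List U, List.Forall₂ (fun x ξ => P ξ x) xs f.inSorts →
    P f.outSort (f.fn xs) ∧ v (f.fn xs) = (xs.map v).sum

theorem applyChunks_respects (hs : List (HetOp I U)) (hR : ∀ h ∈ hs, Respects P v h)
    (ss : List I) (hss : List.Forall₂ (fun (h : HetOp I U) ξ => h.outSort = ξ) hs ss)
    (xs : List U) (hxs : List.Forall₂ (fun x ξ => P ξ x) xs (hs.map HetOp.inSorts).flatten) :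
    List.Forall₂ (fun x ξ => P ξ x) (applyChunks hs xs) ss ∧
      ((applyChunks hs xs).map v).sum = (xs.map v).sum := by
  induction hs generalizing ss xs with
  | nil =>
    cases hss
    cases hxs
    simp [applyChunks]
  | cons h t ih =>
    cases hss with
    | cons h1 h2 =>
      rw [List.map_cons, List.flatten_cons] at hxs
      have ht := List.forall₂_take_append _ _ _ hxs
      have hd := List.forall₂_drop_append _ _ _ hxs
      obtain ⟨hP, hv⟩ := hR h (by simp) _ ht
      obtain ⟨ih1, ih2⟩ := ih (fun k hk => hR k (by simp [hk])) _ h2 _ hd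
      refine ⟨List.Forall₂.cons (h1 ▸ hP) ih1, ?_⟩
      rw [applyChunks, List.map_cons, List.sum_cons, hv, ih2, ← List.sum_append,
        ← List.map_append, List.take_append_drop]

theorem OT.respects (hF : ∀ f ∈ F, Respects P v f) {f : HetOp I U} (hf : OT F f) :
    Respects P v f := by
  induction hf with
  | base h => exact hF _ h
  | id ξ c h1 h2 h3 =>
    intro xs hxs
    rw [h1] at hxs
    obtain ⟨x, _, hx, hnil, rfl⟩ := List.forall₂_cons_right_iff.1 hxs
    cases hnil
    rw [h3, h2]
    exact ⟨hx, by simp⟩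
  | comp g hs hg _ hss ih =>
    intro xs hxs
    obtain ⟨h1, h2⟩ := applyChunks_respects hs ih _ hss xs hxs
    obtain ⟨h3, h4⟩ := hF g hg _ h1
    exact ⟨h3, h4.trans h2⟩

theorem OT.inSorts_ne_nil (hF : ∀ f ∈ F, f.inSorts ≠ []) {f : HetOp I U} (hf : OT F f) :
    f.inSorts ≠ [] := by
  induction hf with
  | base h => exact hF _ h
  | id ξ c h1 h2 h3 => simp [h1]
  | comp g hs hg _ hss ih =>
    cases hss' : hs with
    | nil =>
      subst hss'
      exact absurd (List.forall₂_nil_left_iff.1 hss) (hF g hg)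
    | cons h t =>
      have := ih h (by simp [hss'])
      simp [this]

/-- The identity operation of sort `ξ`. -/
def idOp (d : U) (ξ : I) : HetOp I U := ⟨[ξ], ξ, fun xs => xs.headD d⟩

theorem OT_idOp (d : U) (ξ : I) : OT F (idOp d ξ) :=
  OT.id ξ _ rfl rfl fun _ => rfl

/-- Iterating a binary operation on the phylum `ξ` gives orderly terms of every positive arity. -/
theorem exists_OT_replicate [Nonempty U] {g : HetOp I U} (hg : g ∈ F) {ξ : I}
    (hi : g.inSorts = [ξ, ξ]) (ho : g.outSort = ξ) (k : ℕ) :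
    ∃ f, OT F f ∧ f.inSorts = List.replicate (k + 1) ξ ∧ f.outSort = ξ := by
  obtain ⟨d⟩ := ‹Nonempty U›
  induction k with
  | zero => exact ⟨_, OT_idOp d ξ, rfl, rfl⟩
  | succ k ih =>
    obtain ⟨f, hf, h1, h2⟩ := ih
    refine ⟨_, OT.comp g [idOp d ξ, f] hg ?_ ?_, ?_, ho⟩
    · simp [hf, OT_idOp]
    · simp [hi, h2, idOp]
    · simp [h1, idOp, List.replicate_succ]

/-- A value of an orderly term on a finite subsequence of `a` is the first term of an
`e`-sorted reduction of `a`, provided it lies in the right phylum. -/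
theorem mem_FR_of_OT {A : I → Set U} {e : ℕ → I} (he : InOmega e) {a : ℕ → U}
    (ha : Sorted A e a) {f : HetOp I U} (hf : OT F f) {l : List ℕ}
    (hl : l.IsChain (· < ·)) (hfl : List.Forall₂ (fun i ξ => a i ∈ A ξ) l f.inSorts)
    (h0 : f.fn (l.map a) ∈ A (e 0)) : f.fn (l.map a) ∈ FR A F e a := by
  have hnext : ∀ j m : ℕ, ∃ i, m < i ∧ e i = e j := fun j m => by
    obtain ⟨i, hi, hm⟩ := (he j).exists_gt m
    exact ⟨i, hm, hi⟩
  choose nxt hlt heq using hnext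
  let ι : ℕ → ℕ := fun j => Nat.rec l.sum (fun j m => nxt (j + 1) m) j
  have hι : StrictMono ι := strictMono_nat_of_lt_succ fun j => hlt (j + 1) (ι j)
  have hιe : ∀ j, e (ι (j + 1)) = e (j + 1) := fun j => heq (j + 1) (ι j)
  let φ : ℕ → List ℕ := fun j => Nat.casesOn j l fun j => [ι (j + 1)]
  let t : ℕ → HetOp I U := fun j => Nat.casesOn j f fun j => idOp (a 0) (e (j + 1))
  refine ⟨fun j => (t j).fn ((φ j).map a), ⟨φ, t, ?_, ?_, ?_, ?_, fun _ => rfl⟩, ?_, rfl⟩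
  · rintro (_ | j)
    exacts [hf, OT_idOp _ _]
  · rintro (_ | j)
    exacts [hl, List.isChain_singleton _]
  · rintro j (_ | k) hjk x hx y hy
    · omega
    · obtain rfl : y = ι (k + 1) := by simpa [φ] using hy
      rcases j with _ | j
      · exact (List.le_sum_of_mem hx).trans_lt (hι (Nat.succ_pos k))
      · obtain rfl : x = ι (j + 1) := by simpa [φ] using hx
        exact hι hjk
  · rintro (_ | j)
    · exact hfl
    · exact List.Forall₂.cons (hιe j ▸ ha _) List.Forall₂.nil
  · rintro (_ | j)
    · exact h0
    · exact hιe j ▸ ha _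

end OrderlyTerms

theorem prod_map_mem_FP {M : Type*} [Monoid M] (B : Stream' M) (l : List ℕ) (k : ℕ)
    (hl : l.Pairwise (· < ·)) (hk : ∀ i ∈ l, k ≤ i) (hne : l ≠ []) :
    (l.map B.get).prod ∈ Hindman.FP (B.drop k) := by
  induction l generalizing k with
  | nil => exact absurd rfl hne
  | cons i t ih =>
    have hget : B.get i ∈ Hindman.FP (B.drop i) := by
      have h : (B.drop i).head ∈ Hindman.FP (B.drop i) := Hindman.FP.head (B.drop i)
      rwa [Stream'.head_drop] at h
    have hsub : Hindman.FP (B.drop i) ⊆ Hindman.FP (B.drop k) := by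
      obtain ⟨d, rfl⟩ := Nat.exists_eq_add_of_le (hk i (by simp))
      rw [← Stream'.drop_drop]
      exact Hindman.FP_drop_subset_FP (B.drop k) d
    apply hsub
    by_cases ht : t = []
    · simpa [ht] using hget
    · have h := ih (i + 1) (List.pairwise_cons.1 hl).2 (List.pairwise_cons.1 hl).1 ht
      rw [List.map_cons, List.prod_cons]
      rw [← Stream'.tail_drop'] at h
      have h2 : (B.drop i).head * (t.map B.get).prod ∈ Hindman.FP (B.drop i) :=
        Hindman.FP.cons (B.drop i) _ h
      rwa [Stream'.head_drop] at h2

/-- An ordered form of Hindman's theorem: along any infinite index set, consecutive finite blocks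
can be chosen so that all concatenations of blocks get the same colour. -/
theorem exists_blocks_homogeneous (ι : ℕ → ℕ) (hι : StrictMono ι) (C : List ℕ → Prop) :
    ∃ B : ℕ → List ℕ, (∀ j, B j ≠ []) ∧ (∀ j, ∀ i ∈ B j, i ∈ Set.range ι) ∧
      (∀ j, (B j).Pairwise (· < ·)) ∧ (∀ j k, j < k → ∀ x ∈ B j, ∀ y ∈ B k, x < y) ∧
      ((∀ l : List ℕ, l ≠ [] → l.Pairwise (· < ·) → C (l.map B).flatten) ∨
        (∀ l : List ℕ, l ≠ [] → l.Pairwise (· < ·) → ¬ C (l.map B).flatten)) := by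
  let G : Set (FreeMonoid ℕ) := {w | w.toList ≠ [] ∧ w.toList.Pairwise (· < ·) ∧
    ∀ i ∈ w.toList, i ∈ Set.range ι}
  let K : Set (FreeMonoid ℕ) := {w | C w.toList}
  obtain ⟨S, hS⟩ : ∃ S : Stream' (FreeMonoid ℕ), ∀ i, S.get i = FreeMonoid.of (ι i) :=
    ⟨fun i => FreeMonoid.of (ι i), fun _ => rfl⟩
  have hG : ∀ (s : Stream' (FreeMonoid ℕ)) (w), w ∈ Hindman.FP s → ∀ m, s = S.drop m →
      w ∈ G ∧ ∀ i ∈ w.toList, ι m ≤ i := by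
    intro s w hw
    induction hw with
    | head' s =>
      rintro m rfl
      rw [Stream'.head_drop, hS]
      simp [G]
    | tail' s w _ ih =>
      rintro m rfl
      rw [Stream'.tail_drop'] at ih
      obtain ⟨h1, h2⟩ := ih (m + 1) rfl
      exact ⟨h1, fun i hi => (hι.monotone (Nat.le_succ m)).trans (h2 i hi)⟩
    | cons' s w _ ih =>
      rintro m rfl
      rw [Stream'.tail_drop'] at ih
      obtain ⟨h1, h2⟩ := ih (m + 1) rfl
      have h3 : ∀ i ∈ w.toList, ι m < i := fun i hi => (hι (Nat.lt_succ_self m)).trans_le (h2 i hi)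
      rw [Stream'.head_drop, hS]
      have h4 : (FreeMonoid.of (ι m) * w).toList = ι m :: w.toList := by simp
      refine ⟨⟨?_, ?_, ?_⟩, ?_⟩ <;> rw [h4]
      · simp
      · exact List.pairwise_cons.2 ⟨h3, h1.2.1⟩
      · intro i hi
        rcases List.mem_cons.1 hi with rfl | hi
        exacts [⟨m, rfl⟩, h1.2.2 i hi]
      · intro i hi
        rcases List.mem_cons.1 hi with rfl | hi
        exacts [le_rfl, (h3 i hi).le]
  obtain ⟨c, hc, B, hB⟩ := Hindman.FP_partition_regular S {G ∩ K, G ∩ Kᶜ} (by simp) (by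
      intro w hw
      have := (hG _ w hw 0 rfl).1
      by_cases hK : w ∈ K
      · exact ⟨_, Or.inl rfl, this, hK⟩
      · exact ⟨_, Or.inr rfl, this, hK⟩)
  have hcG : c ⊆ G := by
    rcases hc with rfl | rfl <;> exact Set.inter_subset_left
  have hprod : ∀ l : List ℕ, l ≠ [] → l.Pairwise (· < ·) → (l.map B.get).prod ∈ c :=
    fun l hl hp => hB (prod_map_mem_FP B l 0 hp (by simp) hl)
  have hflat : ∀ l : List ℕ, (l.map B.get).prod.toList =
      (l.map fun j => (B.get j).toList).flatten := by
    intro l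
    induction l with
    | nil => rfl
    | cons i t ih => simp [ih]
  have hone : ∀ j, B.get j ∈ G := fun j => by
    simpa using hcG (hprod [j] (by simp) (by simp))
  refine ⟨fun j => (B.get j).toList, fun j => (hone j).1, fun j => (hone j).2.2,
    fun j => (hone j).2.1, fun j k hjk x hx y hy => ?_, ?_⟩
  · have h := (hcG (hprod [j, k] (by simp) (by simpa using hjk))).2.1
    rw [hflat] at h
    simp only [List.map_cons, List.map_nil, List.flatten_cons, List.flatten_nil,
      List.append_nil] at h
    exact (List.pairwise_append.1 h).2.2 x hx y hy
  · rcases hc with rfl | rfl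
    · refine Or.inl fun l hl hp => ?_
      rw [← hflat]
      exact (hprod l hl hp).2
    · refine Or.inr fun l hl hp => ?_
      rw [← hflat]
      exact (hprod l hl hp).2

section MatrixAlgebra

variable {𝔽 : Type} [Field 𝔽] {n : ℕ}

/-- The operations of the matrix algebra with matrix addition, field addition and determinant. -/
abbrev addDetOps (𝔽 : Type) [Field 𝔽] (n : ℕ) : Set (HetOp (Fin 2) (MatU 𝔽 n)) :=
  {matAddOp 𝔽 n, scalAddOp 𝔽 n, detOp 𝔽 n}

/-- The scalar attached to an element: itself, or its determinant. -/
def scalarValue : MatU 𝔽 n → 𝔽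
  | Sum.inl r => r
  | Sum.inr m => m.det

theorem mem_matPhyla_zero {𝔽 : Type} {n : ℕ} {x : MatU 𝔽 n} : x ∈ matPhyla 𝔽 n 0 ↔ ∃ r, x = Sum.inl r := by
  simp [matPhyla, eq_comm]

theorem mem_matPhyla_one {𝔽 : Type} {n : ℕ} {x : MatU 𝔽 n} : x ∈ matPhyla 𝔽 n 1 ↔ ∃ m, x = Sum.inr m := by
  simp [matPhyla, eq_comm]

theorem addDetOps_inSorts_ne_nil : ∀ f ∈ addDetOps 𝔽 n, f.inSorts ≠ [] := by
  rintro f (rfl | rfl | rfl) <;> simp [matAddOp, scalAddOp, detOp]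

theorem forall₂_singleton {α β : Type*} {R : α → β → Prop} {xs : List α} {b : β}
    (h : List.Forall₂ R xs [b]) : ∃ x, xs = [x] ∧ R x b := by
  obtain ⟨x, _, hx, hnil, rfl⟩ := List.forall₂_cons_right_iff.1 h
  cases hnil
  exact ⟨x, rfl, hx⟩

theorem forall₂_pair {α β : Type*} {R : α → β → Prop} {xs : List α} {b c : β}
    (h : List.Forall₂ R xs [b, c]) : ∃ x y, xs = [x, y] ∧ R x b ∧ R y c := by
  obtain ⟨x, _, hx, ht, rfl⟩ := List.forall₂_cons_right_iff.1 h
  obtain ⟨y, rfl, hy⟩ := forall₂_singleton ht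
  exact ⟨x, y, rfl, hx, hy⟩

theorem addDetOps_respects_scalarValue :
    ∀ f ∈ addDetOps 𝔽 1, Respects (fun ξ x => x ∈ matPhyla 𝔽 1 ξ) scalarValue f := by
  rintro f (rfl | rfl | rfl) xs hxs
  · obtain ⟨x, y, rfl, hx, hy⟩ := forall₂_pair hxs
    obtain ⟨p, rfl⟩ := mem_matPhyla_one.1 hx
    obtain ⟨q, rfl⟩ := mem_matPhyla_one.1 hy
    exact ⟨mem_matPhyla_one.2 ⟨_, rfl⟩, by simp [matAddOp, scalarValue, toMat]⟩
  · obtain ⟨x, y, rfl, hx, hy⟩ := forall₂_pair hxs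
    obtain ⟨p, rfl⟩ := mem_matPhyla_zero.1 hx
    obtain ⟨q, rfl⟩ := mem_matPhyla_zero.1 hy
    exact ⟨mem_matPhyla_zero.2 ⟨_, rfl⟩, by simp [scalAddOp, scalarValue, toScal]⟩
  · obtain ⟨x, rfl, hx⟩ := forall₂_singleton hxs
    obtain ⟨p, rfl⟩ := mem_matPhyla_one.1 hx
    exact ⟨mem_matPhyla_zero.2 ⟨_, rfl⟩, by simp [detOp, scalarValue, toMat]⟩

/-- `x` has sort `ξ`, and if it is a matrix then it is a scalar matrix given by a natural number
at least `N`. -/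
def IsNatScalarMatrix (N : ℕ) (ξ : Fin 2) (x : MatU 𝔽 n) : Prop :=
  x ∈ matPhyla 𝔽 n ξ ∧ ∀ m, x = Sum.inr m → ∃ k : ℕ, N ≤ k ∧ m = (k : 𝔽) • 1

theorem addDetOps_respects_isNatScalarMatrix (N : ℕ) :
    ∀ f ∈ addDetOps 𝔽 n, Respects (IsNatScalarMatrix N) (fun _ => (0 : ℕ)) f := by
  rintro f (rfl | rfl | rfl) xs hxs
  · obtain ⟨x, y, rfl, hx, hy⟩ := forall₂_pair hxs
    obtain ⟨p, rfl⟩ := mem_matPhyla_one.1 hx.1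
    obtain ⟨q, rfl⟩ := mem_matPhyla_one.1 hy.1
    obtain ⟨k, hk, rfl⟩ := hx.2 _ rfl
    obtain ⟨l, hl, rfl⟩ := hy.2 _ rfl
    refine ⟨⟨mem_matPhyla_one.2 ⟨_, rfl⟩, fun m hm => ⟨k + l, by omega, ?_⟩⟩, by simp⟩
    rw [← Sum.inr_injective hm, Nat.cast_add, add_smul]
    rfl
  · obtain ⟨x, y, rfl, -, -⟩ := forall₂_pair hxs
    exact ⟨⟨mem_matPhyla_zero.2 ⟨_, rfl⟩, fun m hm => nomatch hm⟩, by simp⟩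
  · obtain ⟨x, rfl, -⟩ := forall₂_singleton hxs
    exact ⟨⟨mem_matPhyla_zero.2 ⟨_, rfl⟩, fun m hm => nomatch hm⟩, by simp⟩

theorem exists_OT_addDetOps {ξ η : Fin 2} (h : η = 0 ∨ ξ = 1) (k : ℕ) :
    ∃ f, OT (addDetOps 𝔽 n) f ∧ f.inSorts = List.replicate (k + 1) ξ ∧ f.outSort = η := by
  have hmat : ∃ f, OT (addDetOps 𝔽 n) f ∧ f.inSorts = List.replicate (k + 1) 1 ∧ f.outSort = 1 :=
    exists_OT_replicate (g := matAddOp 𝔽 n) (by simp) rfl rfl k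
  have hscal : ∃ f, OT (addDetOps 𝔽 n) f ∧ f.inSorts = List.replicate (k + 1) 0 ∧ f.outSort = 0 :=
    exists_OT_replicate (g := scalAddOp 𝔽 n) (by simp) rfl rfl k
  have hdet : ∃ f, OT (addDetOps 𝔽 n) f ∧ f.inSorts = List.replicate (k + 1) 1 ∧ f.outSort = 0 := by
    obtain ⟨f, hf, h1, h2⟩ := hmat
    refine ⟨_, OT.comp (detOp 𝔽 n) [f] (by simp) (by simpa using hf) (by simp [detOp, h2]), ?_, rfl⟩
    simpa using h1
  fin_cases ξ <;> fin_cases η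
  exacts [hscal, by simp at h, hdet, hmat]

theorem isERamsey_one {e : ℕ → Fin 2} (he : InOmega e) (he0 : e 0 = 0) :
    IsERamsey (matPhyla 𝔽 1) (addDetOps 𝔽 1) e := by
  intro b hb X hX
  obtain ⟨ξ, hinf, hξ⟩ : ∃ ξ, {i | e i = ξ}.Infinite ∧ ∀ j, e j = 0 ∨ ξ = 1 := by
    by_cases h : ∃ i, e i = 1
    · obtain ⟨i, hi⟩ := h
      exact ⟨1, hi ▸ he i, fun _ => Or.inr rfl⟩
    · exact ⟨0, he0 ▸ he 0, fun j => Or.inl (by have := not_exists.1 h j; omega)⟩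
  obtain ⟨B, hne, hran, hpw, hlt, hhom⟩ := exists_blocks_homogeneous
    (Nat.nth fun i => e i = ξ) (Nat.nth_strictMono hinf)
    fun l => Sum.inl (l.map (scalarValue ∘ b)).sum ∈ X
  have hBξ : ∀ j, ∀ i ∈ B j, e i = ξ := fun j i hi => by
    obtain ⟨m, rfl⟩ := hran j i hi
    exact Nat.nth_mem_of_infinite hinf m
  have hterm : ∀ j, ∃ f, OT (addDetOps 𝔽 1) f ∧
      f.inSorts = List.replicate (B j).length ξ ∧ f.outSort = e j := fun j => by
    obtain ⟨k, hk⟩ := Nat.exists_eq_succ_of_ne_zero (mt List.length_eq_zero_iff.1 (hne j))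
    rw [hk]
    exact exists_OT_addDetOps (hξ j) k
  choose t ht htin htout using hterm
  have hsort : ∀ j, List.Forall₂ (fun i ξ => b i ∈ matPhyla 𝔽 1 ξ) (B j) (t j).inSorts := by
    intro j
    rw [htin, List.forall₂_iff_get]
    refine ⟨by simp, fun i h1 h2 => ?_⟩
    have := hb ((B j).get ⟨i, h1⟩)
    rw [hBξ j _ (List.get_mem _ _)] at this
    simpa using this
  have hR := fun j => (ht j).respects addDetOps_respects_scalarValue ((B j).map b)
    (List.forall₂_map_left_iff.2 (hsort j))
  let a : ℕ → MatU 𝔽 1 := fun j => (t j).fn ((B j).map b)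
  have hval : ∀ x ∈ FR (matPhyla 𝔽 1) (addDetOps 𝔽 1) e a, ∃ l : List ℕ, l ≠ [] ∧
      l.Pairwise (· < ·) ∧
        x = Sum.inl (((l.map B).flatten).map (scalarValue ∘ b)).sum := by
    rintro _ ⟨a', ⟨φ, f, hf, hch, -, hfor, heq⟩, hs, rfl⟩
    refine ⟨φ 0, ?_, List.isChain_iff_pairwise.1 (hch 0), ?_⟩
    · intro h
      have := hfor 0
      rw [h] at this
      exact (hf 0).inSorts_ne_nil addDetOps_inSorts_ne_nil (List.forall₂_nil_left_iff.1 this)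
    · have h := ((hf 0).respects addDetOps_respects_scalarValue ((φ 0).map a)
        (List.forall₂_map_left_iff.2 (hfor 0))).2
      rw [← heq 0] at h
      have h0 := hs 0
      rw [he0] at h0
      obtain ⟨r, hr⟩ := mem_matPhyla_zero.1 h0
      rw [hr] at h ⊢
      have hflat : ∀ l : List ℕ, ((l.map a).map scalarValue).sum =
          (((l.map B).flatten).map (scalarValue ∘ b)).sum := by
        intro l
        induction l with
        | nil => rfl
        | cons i s ih =>
          have hi := (hR i).2
          rw [List.map_map] at hi
          simp only [List.map_cons, List.sum_cons, List.flatten_cons, List.map_append,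
            List.sum_append, ih]
          rw [← hi]
      rw [← hflat, ← h]
      rfl
  refine ⟨a, ⟨B, t, ht, fun j => List.isChain_iff_pairwise.2 (hpw j), hlt, hsort,
    fun _ => rfl⟩, fun j => htout j ▸ (hR j).1, ?_⟩
  rcases hhom with hhom | hhom
  · left
    intro x hx
    obtain ⟨l, hl, hp, rfl⟩ := hval x hx
    exact hhom l hl hp
  · right
    rw [Set.eq_empty_iff_forall_notMem]
    rintro x ⟨hx, hxX⟩
    obtain ⟨l, hl, hp, rfl⟩ := hval x hx
    exact hhom l hl hp hxX

/-- For `n > 1`, adding a small positive number to an `n`-th power never gives an `n`-th power. -/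
theorem pow_add_ne_pow {n s t m : ℕ} (hn : 1 < n) (hs : 0 < s) (hst : s ≤ t) :
    s + t ^ n ≠ m ^ n := by
  intro h
  have h1 : t < m := lt_of_pow_lt_pow_left₀ n (Nat.zero_le m) (by omega)
  have h2 : (t + 1) ^ n ≤ m ^ n := Nat.pow_le_pow_left h1 n
  obtain ⟨d, rfl⟩ := Nat.exists_eq_add_of_le' hn
  have h5 : (t + 1) ^ d ≥ 1 := Nat.one_le_pow _ _ (by omega)
  have h6 : t ^ d ≤ (t + 1) ^ d := Nat.pow_le_pow_left (Nat.le_succ t) _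
  have e1 : (t + 1) ^ (d + 2) = (t + 1) ^ d * (t * t + 2 * t + 1) := by ring
  have e2 : t ^ (d + 2) = t ^ d * (t * t) := by ring
  rw [e1] at h2
  rw [e2] at h
  nlinarith [Nat.mul_le_mul_right (t * t) h6, Nat.mul_le_mul_right (2 * t + 1) h5]

theorem not_isERamsey [CharZero 𝔽] (hn : 1 < n) {e : ℕ → Fin 2} (he : InOmega e)
    (he0 : e 0 = 0) (h1 : ∃ i, e i = 1) :
    ¬ IsERamsey (matPhyla 𝔽 n) (addDetOps 𝔽 n) e := by
  intro hRam
  let b : ℕ → MatU 𝔽 n := fun i =>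
    if e i = 0 then Sum.inl 0 else Sum.inr (((i + 1 : ℕ) : 𝔽) • 1)
  have hb : Sorted (matPhyla 𝔽 n) e b := by
    intro i
    by_cases h : e i = 0
    · simp [b, h, matPhyla]
    · simp [b, h, matPhyla]
  obtain ⟨a, ⟨φ, f, hf, -, hlt, hfor, heq⟩, ha, hX⟩ := hRam b hb
    {y | ∃ k : ℕ, y = Sum.inl ((k : 𝔽) ^ n)} (by
      rintro _ ⟨k, rfl⟩
      rw [he0]
      exact mem_matPhyla_zero.2 ⟨_, rfl⟩)
  have hne : ∀ j, φ j ≠ [] := fun j h => by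
    have := hfor j
    rw [h] at this
    exact (hf j).inSorts_ne_nil addDetOps_inSorts_ne_nil (List.forall₂_nil_left_iff.1 this)
  have hge : ∀ j, ∀ x ∈ φ j, j ≤ x := by
    intro j
    induction j with
    | zero => exact fun x _ => Nat.zero_le x
    | succ j ih =>
      intro x hx
      obtain ⟨y, hy⟩ := List.exists_mem_of_ne_nil _ (hne j)
      exact (ih y hy).trans_lt (hlt j (j + 1) (Nat.lt_succ_self j) y hy x hx)
  have hmat : ∀ j, e j = 1 → ∃ k : ℕ, j + 1 ≤ k ∧ a j = Sum.inr ((k : 𝔽) • 1) := by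
    intro j hj
    have hP : List.Forall₂ (fun x ξ => IsNatScalarMatrix (j + 1) ξ x) ((φ j).map b)
        (f j).inSorts := by
      rw [List.forall₂_map_left_iff]
      have h := hfor j
      rw [List.forall₂_iff_get] at h ⊢
      refine ⟨h.1, fun i h1 h2 => ⟨h.2 i h1 h2, fun m hm => ?_⟩⟩
      refine ⟨(φ j).get ⟨i, h1⟩ + 1, Nat.succ_le_succ (hge j _ (List.get_mem _ _)), ?_⟩
      by_cases h0 : e ((φ j).get ⟨i, h1⟩) = 0
      · simp only [b, if_pos h0] at hm
        exact nomatch hm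
      · simp only [b, if_neg h0] at hm
        exact (Sum.inr_injective hm).symm
    have h := ((hf j).respects (addDetOps_respects_isNatScalarMatrix (j + 1)) _ hP).1
    rw [← heq j] at h
    have haj := ha j
    rw [hj] at haj
    obtain ⟨m, hm⟩ := mem_matPhyla_one.1 haj
    obtain ⟨k, hk, rfl⟩ := h.2 m hm
    exact ⟨k, hk, hm⟩
  obtain ⟨p, hp⟩ := h1
  obtain ⟨s, hs, has⟩ := hmat p hp
  obtain ⟨q, hq, hpq⟩ := (he p).exists_gt (max p (s ^ n))
  obtain ⟨t, ht, hat⟩ := hmat q (hq.trans hp)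
  have hpm : a p ∈ matPhyla 𝔽 n 1 := mem_matPhyla_one.2 ⟨_, has⟩
  have hqm : a q ∈ matPhyla 𝔽 n 1 := mem_matPhyla_one.2 ⟨_, hat⟩
  have hdet : OT (addDetOps 𝔽 n) (detOp 𝔽 n) := OT.base (by simp)
  have hmem1 : (Sum.inl ((s : 𝔽) ^ n) : MatU 𝔽 n) ∈
      FR (matPhyla 𝔽 n) (addDetOps 𝔽 n) e a := by
    have hfn : (detOp 𝔽 n).fn ([p].map a) = Sum.inl ((s : 𝔽) ^ n) := by
      simp [detOp, has, toMat]
    rw [← hfn]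
    refine mem_FR_of_OT he ha hdet (List.isChain_singleton _) (by simpa [detOp] using hpm) ?_
    rw [hfn, he0]
    exact mem_matPhyla_zero.2 ⟨_, rfl⟩
  have hmem2 : (Sum.inl ((s : 𝔽) ^ n + (t : 𝔽) ^ n) : MatU 𝔽 n) ∈
      FR (matPhyla 𝔽 n) (addDetOps 𝔽 n) e a := by
    have hsum := OT.comp (F := addDetOps 𝔽 n) (scalAddOp 𝔽 n) [detOp 𝔽 n, detOp 𝔽 n]
      (by simp) (by simpa using hdet) (by simp [scalAddOp, detOp])
    have hfn : (scalAddOp 𝔽 n).fn (applyChunks [detOp 𝔽 n, detOp 𝔽 n] ([p, q].map a)) =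
        Sum.inl ((s : 𝔽) ^ n + (t : 𝔽) ^ n) := by
      simp [applyChunks, scalAddOp, detOp, has, hat, toMat, toScal]
    rw [← hfn]
    refine mem_FR_of_OT he ha hsum (by simp; omega) (by simpa [detOp] using ⟨hpm, hqm⟩) ?_
    rw [hfn, he0]
    exact mem_matPhyla_zero.2 ⟨_, rfl⟩
  rcases hX with hX | hX
  · obtain ⟨m, hm⟩ := hX hmem2
    have hm' := Sum.inl_injective hm
    exact pow_add_ne_pow hn (Nat.pow_pos (by omega)) (by omega : s ^ n ≤ t)
      (m := m) (by exact_mod_cast hm')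
  · exact (Set.eq_empty_iff_forall_notMem.1 hX) _ ⟨hmem1, s, rfl⟩

end MatrixAlgebra

end HetRamsey

open HetRamsey

/-- (1) if `n = 1` then `(M₁(𝔽), 𝔽, +, +_𝔽, |·|)` is `e`-Ramsey
for every `e ∈ Ω₀`; (2) if `n > 1` then `(Mₙ(𝔽), 𝔽, +, +_𝔽, |·|)` is not
`e`-Ramsey for any nonconstant `e ∈ Ω₀`. -/
theorem matAdd_scalAdd_det_eRamsey_iff_dim_one
    (𝔽 : Type) [Field 𝔽] [CharZero 𝔽] (n : ℕ) (hn : 0 < n) :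
    (n = 1 → ∀ e : ℕ → Fin 2, InOmega e → e 0 = 0 →
      IsERamsey (matPhyla 𝔽 n) {matAddOp 𝔽 n, scalAddOp 𝔽 n, detOp 𝔽 n} e) ∧
    (1 < n → ∀ e : ℕ → Fin 2, InOmega e → e 0 = 0 → (∃ i j, e i ≠ e j) →
      ¬ IsERamsey (matPhyla 𝔽 n) {matAddOp 𝔽 n, scalAddOp 𝔽 n, detOp 𝔽 n} e) := by
  refine ⟨?_, fun h1 e he he0 hnc => not_isERamsey h1 he he0 ?_⟩
  · rintro rfl e he he0
    exact isERamsey_one he he0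
  · obtain ⟨i, j, hij⟩ := hnc
    by_contra! h
    have hi := h i
    have hj := h j
    omega
end
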